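/- In the case of no augmentation (p = 0) and no acceleration (ρ(t) = t): suppose λ_n ≥ 0 and λ_k > 0, let X = Q Λ^q Qᵀ X₀ = A^q X₀ for X₀ ∈ ℝ^{n×k} with min_{i≤k} ‖q_iᵀX₀‖₂ > 0, and suppose the G₁-Assumption holds with m = k. Then δ_k(Y) ≤ C₀ · (λ_{k+1}/λ_k)^q, where C₀ = Γ_{k,k}(QᵀX₀) · Γ_{k,k}(V) · ‖G₁†E_k‖₂. -/

import Mathlib

open Matrix

namespace ARR

/-- Euclidean norm of the `i`-th row of a matrix. -/
noncomputable def rowNorm {R C : Type*} [Fintype C] (M : Matrix R C ℝ) (i : R) : ℝ :=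
  Real.sqrt (∑ j, M i j ^ 2)

/-- Supremum of `f` over indices satisfying `P`. -/
noncomputable def supOver {n : ℕ} (P : Fin n → Prop) (f : Fin n → ℝ) : ℝ :=
  sSup (f '' {i | P i})

/-- Infimum of `f` over indices satisfying `P`. -/
noncomputable def infOver {n : ℕ} (P : Fin n → Prop) (f : Fin n → ℝ) : ℝ :=
  sInf (f '' {i | P i})

/-- The accuracy measure `δₖ(Z) = max_{i>k} ‖qᵢᵀZ‖ / min_{i≤k} ‖qᵢᵀZ‖`
(indices are 1-based in the paper; here `i > k` means `k ≤ i` for 0-based `i`). -/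
noncomputable def deltaK {n k : ℕ} (Q : Matrix (Fin n) (Fin n) ℝ)
    (Z : Matrix (Fin n) (Fin k) ℝ) : ℝ :=
  supOver (fun i => k ≤ (i : ℕ)) (rowNorm (Qᵀ * Z)) /
    infOver (fun i => (i : ℕ) < k) (rowNorm (Qᵀ * Z))

/-- `Γ_{k,m}(M) = max_{i>m} ‖eᵢᵀM‖ / min_{i≤k} ‖eᵢᵀM‖`. -/
noncomputable def gammaKM {n : ℕ} {C : Type*} [Fintype C] (k m : ℕ)
    (M : Matrix (Fin n) C ℝ) : ℝ :=
  supOver (fun i => m ≤ (i : ℕ)) (rowNorm M) / infOver (fun i => (i : ℕ) < k) (rowNorm M)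

/-- Spectral (operator 2-) norm of a matrix. -/
noncomputable def specNorm {a b : Type*} [Fintype a] [Fintype b] [DecidableEq b]
    (M : Matrix a b ℝ) : ℝ :=
  ‖LinearMap.toContinuousLinearMap (Matrix.toEuclideanLin M)‖

/-- The Vandermonde matrix `V` with `V i j = λᵢ^j`, `0 ≤ j ≤ p`. -/
def vand {n : ℕ} (lam : Fin n → ℝ) (p : ℕ) : Matrix (Fin n) (Fin (p + 1)) ℝ :=
  fun i j => lam i ^ (j : ℕ)

/-- The diagonal of `D`: `Dᵢᵢ = ‖qᵢᵀX‖₂ ⬝ ‖eᵢᵀV‖₂` (the norm of the `i`-th row of `Ĝ`). -/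
noncomputable def dvec {n k : ℕ} (lam : Fin n → ℝ) (p : ℕ) (Q : Matrix (Fin n) (Fin n) ℝ)
    (X : Matrix (Fin n) (Fin k) ℝ) : Fin n → ℝ :=
  fun i => rowNorm (Qᵀ * X) i * rowNorm (vand lam p) i

/-- `G = D† Ĝ`, where `Ĝ = [QᵀX, ΛQᵀX, …, ΛᵖQᵀX]`; the column block index is `j.1`. -/
noncomputable def gmat {n k : ℕ} (lam : Fin n → ℝ) (p : ℕ) (Q : Matrix (Fin n) (Fin n) ℝ)
    (X : Matrix (Fin n) (Fin k) ℝ) : Matrix (Fin n) (Fin (p + 1) × Fin k) ℝ :=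
  fun i j => (dvec lam p Q X i)⁻¹ * (lam i ^ (j.1 : ℕ) * (Qᵀ * X) i j.2)

/-- The augmented matrix `X_p = [X, AX, …, AᵖX]`; the column block index is `j.1`. -/
noncomputable def aug {n k : ℕ} (A : Matrix (Fin n) (Fin n) ℝ)
    (X : Matrix (Fin n) (Fin k) ℝ) (p : ℕ) : Matrix (Fin n) (Fin (p + 1) × Fin k) ℝ :=
  fun i j => (A ^ (j.1 : ℕ) * X) i j.2

/-- First `m` rows of a matrix. -/
def topRows {n : ℕ} {C : Type*} (m : ℕ) (hmn : m ≤ n) (M : Matrix (Fin n) C ℝ) :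
    Matrix (Fin m) C ℝ :=
  fun i j => M (Fin.castLE hmn i) j

/-- Last `n - m` rows of a matrix. -/
def lowRows {n : ℕ} {C : Type*} (m : ℕ) (hmn : m ≤ n) (M : Matrix (Fin n) C ℝ) :
    Matrix (Fin (n - m)) C ℝ :=
  fun i j => M ⟨m + (i : ℕ), by have := i.isLt; omega⟩ j

/-- First `m` columns of a square matrix (`Q_m`). -/
def colsTop {n : ℕ} (m : ℕ) (hmn : m ≤ n) (M : Matrix (Fin n) (Fin n) ℝ) :
    Matrix (Fin n) (Fin m) ℝ :=
  fun i j => M i (Fin.castLE hmn j)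

/-- Last `n - m` columns of a square matrix (`Q_{m+}`). -/
def colsLow {n : ℕ} (m : ℕ) (hmn : m ≤ n) (M : Matrix (Fin n) (Fin n) ℝ) :
    Matrix (Fin n) (Fin (n - m)) ℝ :=
  fun i j => M i ⟨m + (j : ℕ), by have := j.isLt; omega⟩

/-- `E_k`: the first `k` columns of the `m × m` identity matrix. -/
def ekMat (m k : ℕ) : Matrix (Fin m) (Fin k) ℝ :=
  fun i j => if (i : ℕ) = (j : ℕ) then 1 else 0

/-- `D₁⁻¹`: the inverse of the leading `m × m` block of `D`. -/
noncomputable def d1inv {n : ℕ} (m : ℕ) (hmn : m ≤ n) (d : Fin n → ℝ) :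
    Matrix (Fin m) (Fin m) ℝ :=
  Matrix.diagonal fun i => (d (Fin.castLE hmn i))⁻¹

/-- `D₂`: the trailing `(n-m) × (n-m)` block of `D`. -/
noncomputable def d2mat {n : ℕ} (m : ℕ) (hmn : m ≤ n) (d : Fin n → ℝ) :
    Matrix (Fin (n - m)) (Fin (n - m)) ℝ :=
  Matrix.diagonal fun i => d ⟨m + (i : ℕ), by have := i.isLt; omega⟩

/-- `Y = X_p G₁† D₁⁻¹ E_k`, where `A = Q Λ Qᵀ` and `X_p = [X, AX, …, AᵖX]`. -/
noncomputable def ymat {n k : ℕ} (m : ℕ) (hmn : m ≤ n) (lam : Fin n → ℝ) (p : ℕ)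
    (Q : Matrix (Fin n) (Fin n) ℝ) (X : Matrix (Fin n) (Fin k) ℝ)
    (Gpinv : Matrix (Fin (p + 1) × Fin k) (Fin m) ℝ) : Matrix (Fin n) (Fin k) ℝ :=
  aug (Q * Matrix.diagonal lam * Qᵀ) X p * Gpinv * d1inv m hmn (dvec lam p Q X) * ekMat m k

end ARR

namespace ARR

theorem rowNorm_eq_norm {R C : Type*} [Fintype C] (M : Matrix R C ℝ) (i : R) :
    rowNorm M i = ‖WithLp.toLp 2 (M i)‖ := by
  simp [rowNorm, EuclideanSpace.norm_eq]

theorem rowNorm_nonneg {R C : Type*} [Fintype C] (M : Matrix R C ℝ) (i : R) :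
    0 ≤ rowNorm M i :=
  Real.sqrt_nonneg _

theorem rowNorm_eq_mul {R C : Type*} [Fintype C] {M N : Matrix R C ℝ} {i : R} {c : ℝ}
    (hc : 0 ≤ c) (h : ∀ j, M i j = c * N i j) : rowNorm M i = c * rowNorm N i := by
  have hs : (∑ j, M i j ^ 2) = c ^ 2 * ∑ j, N i j ^ 2 := by
    rw [Finset.mul_sum]
    exact Finset.sum_congr rfl fun j _ => by rw [h, mul_pow]
  rw [rowNorm, rowNorm, hs, Real.sqrt_mul (sq_nonneg c), Real.sqrt_sq hc]

theorem rowNorm_mul_le {R a b : Type*} [Fintype a] [Fintype b] [DecidableEq b]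
    (M : Matrix R a ℝ) (B : Matrix a b ℝ) (i : R) :
    rowNorm (M * B) i ≤ rowNorm M i * specNorm B := by
  have hsq : rowNorm (M * B) i ^ 2 ≤
      rowNorm M i * (specNorm B * rowNorm (M * B) i) := by
    have h1 : rowNorm (M * B) i ^ 2 = inner ℝ (WithLp.toLp 2 (M i))
        (Matrix.toEuclideanLin B (WithLp.toLp 2 ((M * B) i))) := by
      rw [rowNorm, Real.sq_sqrt (Finset.sum_nonneg fun j _ => sq_nonneg _)]
      have e : (∑ j, (M * B) i j ^ 2) = (M i ᵥ* B) ⬝ᵥ ((M * B) i) :=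
        Finset.sum_congr rfl fun j _ => by rw [sq]; rfl
      rw [e, ← Matrix.dotProduct_mulVec, EuclideanSpace.inner_eq_star_dotProduct,
        dotProduct_comm]
      rfl
    rw [h1, rowNorm_eq_norm, rowNorm_eq_norm]
    refine (real_inner_le_norm _ _).trans ?_
    gcongr
    exact (LinearMap.toContinuousLinearMap (Matrix.toEuclideanLin B)).le_opNorm _
  rcases (rowNorm_nonneg (M * B) i).eq_or_lt with h | h
  · rw [← h]
    exact mul_nonneg (rowNorm_nonneg _ _) (norm_nonneg _)
  · nlinarith

theorem rowNorm_mul_diagonal_le {R a : Type*} [Fintype a] [DecidableEq a]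
    (M : Matrix R a ℝ) (d : a → ℝ) {c : ℝ} (hd0 : ∀ j, 0 ≤ d j) (hd : ∀ j, d j ≤ c)
    (hc : 0 ≤ c) (i : R) : rowNorm (M * Matrix.diagonal d) i ≤ rowNorm M i * c := by
  refine Real.sqrt_le_iff.mpr ⟨mul_nonneg (rowNorm_nonneg _ _) hc, ?_⟩
  rw [mul_pow, rowNorm, Real.sq_sqrt (Finset.sum_nonneg fun j _ => sq_nonneg _),
    Finset.sum_mul]
  refine Finset.sum_le_sum fun j _ => ?_
  rw [Matrix.mul_diagonal, mul_pow]
  exact mul_le_mul_of_nonneg_left (pow_le_pow_left₀ (hd0 j) (hd j) 2) (sq_nonneg _)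

theorem le_supOver {n : ℕ} {P : Fin n → Prop} (f : Fin n → ℝ) {i : Fin n} (hi : P i) :
    f i ≤ supOver P f :=
  le_csSup (Set.toFinite _).bddAbove ⟨i, hi, rfl⟩

theorem infOver_le {n : ℕ} {P : Fin n → Prop} (f : Fin n → ℝ) {i : Fin n} (hi : P i) :
    infOver P f ≤ f i :=
  csInf_le (Set.toFinite _).bddBelow ⟨i, hi, rfl⟩

theorem supOver_le {n : ℕ} {P : Fin n → Prop} {f : Fin n → ℝ} {c : ℝ} {i : Fin n} (hi : P i)
    (h : ∀ j, P j → f j ≤ c) : supOver P f ≤ c :=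
  csSup_le ⟨_, i, hi, rfl⟩ (by rintro _ ⟨j, hj, rfl⟩; exact h j hj)

theorem image_eq_singleton_of_const {n : ℕ} {P : Fin n → Prop} {f : Fin n → ℝ} {c : ℝ}
    {i : Fin n} (hi : P i) (h : ∀ j, P j → f j = c) : f '' {j | P j} = {c} := by
  ext x
  constructor
  · rintro ⟨j, hj, rfl⟩
    exact h j hj
  · rintro rfl
    exact ⟨i, hi, h i hi⟩

theorem supOver_eq_of_const {n : ℕ} {P : Fin n → Prop} {f : Fin n → ℝ} {c : ℝ} {i : Fin n}
    (hi : P i) (h : ∀ j, P j → f j = c) : supOver P f = c := by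
  rw [supOver, image_eq_singleton_of_const hi h, csSup_singleton]

theorem infOver_eq_of_const {n : ℕ} {P : Fin n → Prop} {f : Fin n → ℝ} {c : ℝ} {i : Fin n}
    (hi : P i) (h : ∀ j, P j → f j = c) : infOver P f = c := by
  rw [infOver, image_eq_singleton_of_const hi h, csInf_singleton]

theorem rowNorm_vand_zero {n : ℕ} (lam : Fin n → ℝ) (i : Fin n) :
    rowNorm (vand lam 0) i = 1 := by
  simp [rowNorm, vand]

theorem dvec_zero {n k : ℕ} (lam : Fin n → ℝ) (Q : Matrix (Fin n) (Fin n) ℝ)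
    (X : Matrix (Fin n) (Fin k) ℝ) (i : Fin n) :
    dvec lam 0 Q X i = rowNorm (Qᵀ * X) i := by
  rw [dvec, rowNorm_vand_zero, mul_one]

theorem gammaKM_vand_zero {n k : ℕ} (hk : 0 < k) (hkn : k < n) (lam : Fin n → ℝ) :
    gammaKM k k (vand lam 0) = 1 := by
  have hs : supOver (fun i : Fin n => k ≤ (i : ℕ)) (rowNorm (vand lam 0)) = 1 :=
    supOver_eq_of_const (i := ⟨k, hkn⟩) le_rfl fun j _ => rowNorm_vand_zero lam j
  have hi : infOver (fun i : Fin n => (i : ℕ) < k) (rowNorm (vand lam 0)) = 1 :=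
    infOver_eq_of_const (i := ⟨0, hk.trans hkn⟩) hk fun j _ => rowNorm_vand_zero lam j
  rw [gammaKM, hs, hi, div_one]

theorem ekMat_self (k : ℕ) : ekMat k k = 1 := by
  ext i j
  simp [ekMat, Matrix.one_apply, Fin.ext_iff]

theorem transpose_mul_aug_zero {n k : ℕ} (A Q : Matrix (Fin n) (Fin n) ℝ)
    (X : Matrix (Fin n) (Fin k) ℝ) :
    Qᵀ * aug A X 0 = (Qᵀ * X).submatrix id Prod.snd := by
  have h : aug A X 0 = X.submatrix id Prod.snd := by
    ext i j
    simp [aug]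
  rw [h]
  rfl

theorem rowNorm_submatrix_snd {n k : ℕ} (P : Matrix (Fin n) (Fin k) ℝ) (i : Fin n) :
    rowNorm (P.submatrix id (Prod.snd : Fin (0 + 1) × Fin k → Fin k)) i = rowNorm P i := by
  simp [rowNorm, Fintype.sum_prod_type]

theorem transpose_mul_ymat_zero {n k : ℕ} (hkn : k ≤ n) (lam : Fin n → ℝ)
    (Q : Matrix (Fin n) (Fin n) ℝ) (X : Matrix (Fin n) (Fin k) ℝ)
    (Gpinv : Matrix (Fin (0 + 1) × Fin k) (Fin k) ℝ) :
    Qᵀ * ymat k hkn lam 0 Q X Gpinv =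
      (Qᵀ * X).submatrix id (Prod.snd : Fin (0 + 1) × Fin k → Fin k) * Gpinv *
        d1inv k hkn (dvec lam 0 Q X) := by
  rw [ymat, ekMat_self, Matrix.mul_one, ← Matrix.mul_assoc, ← Matrix.mul_assoc,
    transpose_mul_aug_zero]

/-- Under the `G₁`-Assumption, the leading block of `QᵀY` is the identity. -/
theorem transpose_mul_ymat_zero_apply {n k : ℕ} (hkn : k ≤ n) (lam : Fin n → ℝ)
    (Q : Matrix (Fin n) (Fin n) ℝ) (X : Matrix (Fin n) (Fin k) ℝ)
    (Gpinv : Matrix (Fin (0 + 1) × Fin k) (Fin k) ℝ)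
    (hG1 : topRows k hkn (gmat lam 0 Q X) * Gpinv = 1)
    (hpos : ∀ i : Fin k, 0 < rowNorm (Qᵀ * X) (Fin.castLE hkn i)) (i j : Fin k) :
    (Qᵀ * ymat k hkn lam 0 Q X Gpinv) (Fin.castLE hkn i) j =
      (1 : Matrix (Fin k) (Fin k) ℝ) i j := by
  have hd := (hpos i).ne'
  have hrow : ((Qᵀ * X).submatrix id (Prod.snd : Fin (0 + 1) × Fin k → Fin k) * Gpinv)
      (Fin.castLE hkn i) j =
      rowNorm (Qᵀ * X) (Fin.castLE hkn i) * (1 : Matrix (Fin k) (Fin k) ℝ) i j := by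
    rw [← hG1, Matrix.mul_apply, Matrix.mul_apply, Finset.mul_sum]
    refine Finset.sum_congr rfl fun l _ => ?_
    have hl : (l.1 : ℕ) = 0 := by omega
    simp only [topRows, gmat, dvec_zero, hl, pow_zero, one_mul, Matrix.submatrix_apply, id]
    field_simp
  rw [transpose_mul_ymat_zero, d1inv, Matrix.mul_diagonal, hrow, dvec_zero]
  rcases eq_or_ne i j with rfl | h
  · simp [hd]
  · simp [h]

end ARR

open ARR in
/-- Corollary 3.1, special case `p = 0`, `ρ(t) = t`, `m = k`. If
`λ_n ≥ 0`, `λ_k > 0` and `X = A^q X₀`, then under the `G₁`-Assumption (with `m = k`),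
`δₖ(Y) ≤ C₀ (λ_{k+1}/λ_k)^q` where `C₀ = Γ_{k,k}(QᵀX₀) Γ_{k,k}(V) ‖G₁†E_k‖₂`.
(0-based indices: `λ_k = lam ⟨k-1⟩`, `λ_{k+1} = lam ⟨k⟩`, `λ_n = lam ⟨n-1⟩`.) -/
theorem arr_corollary_power_method {n k q : ℕ} (hq : 1 ≤ q) (hk : 0 < k) (hkn : k < n)
    (lam : Fin n → ℝ) (hlam : Antitone lam)
    (hlamn : 0 ≤ lam ⟨n - 1, by omega⟩) (hlamk : 0 < lam ⟨k - 1, by omega⟩)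
    (Q : Matrix (Fin n) (Fin n) ℝ) (hQ : Q * Qᵀ = 1) (hQ' : Qᵀ * Q = 1)
    (X₀ X : Matrix (Fin n) (Fin k) ℝ)
    (hX : X = Q * (Matrix.diagonal lam) ^ q * Qᵀ * X₀)
    (hX₀ : 0 < infOver (fun i => (i : ℕ) < k) (rowNorm (Qᵀ * X₀)))
    (Gpinv : Matrix (Fin (0 + 1) × Fin k) (Fin k) ℝ)
    (hG1 : topRows k hkn.le (gmat lam 0 Q X) * Gpinv = 1) :
    deltaK Q (ymat k hkn.le lam 0 Q X Gpinv) ≤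
      (gammaKM k k (Qᵀ * X₀) * gammaKM k k (vand lam 0) * specNorm (Gpinv * ekMat k k)) *
        (lam ⟨k, hkn⟩ / lam ⟨k - 1, by omega⟩) ^ q := by
  have hmono : ∀ i : Fin n, 0 ≤ lam i := fun i =>
    hlamn.trans (hlam (Fin.mk_le_mk.mpr (by omega) : i ≤ ⟨n - 1, by omega⟩))
  have hP : ∀ i j, (Qᵀ * X) i j = lam i ^ q * (Qᵀ * X₀) i j := by
    intro i j
    have h : Qᵀ * X = Matrix.diagonal (lam ^ q) * (Qᵀ * X₀) := by
      rw [hX, Matrix.diagonal_pow]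
      simp only [← Matrix.mul_assoc]
      rw [hQ', Matrix.one_mul]
    rw [h, Matrix.diagonal_mul, Pi.pow_apply]
  have hPn : ∀ i, rowNorm (Qᵀ * X) i = lam i ^ q * rowNorm (Qᵀ * X₀) i := fun i =>
    rowNorm_eq_mul (pow_nonneg (hmono i) q) (hP i)
  set μ := infOver (fun i : Fin n => (i : ℕ) < k) (rowNorm (Qᵀ * X₀)) with hμ
  set σ := supOver (fun i : Fin n => k ≤ (i : ℕ)) (rowNorm (Qᵀ * X₀)) with hσ
  set a := lam ⟨k - 1, by omega⟩ with ha
  set b := lam ⟨k, hkn⟩ with hb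
  have haμ : 0 < a ^ q * μ := mul_pos (pow_pos hlamk q) hX₀
  have hlow : ∀ i : Fin k, a ^ q * μ ≤ rowNorm (Qᵀ * X) (Fin.castLE hkn.le i) := by
    intro i
    rw [hPn]
    refine mul_le_mul (pow_le_pow_left₀ hlamk.le (hlam ?_) q)
      (infOver_le _ (by simp)) hX₀.le (pow_nonneg (hmono _) q)
    exact Fin.mk_le_mk.mpr (by omega)
  have hpos : ∀ i : Fin k, 0 < rowNorm (Qᵀ * X) (Fin.castLE hkn.le i) := fun i =>
    haμ.trans_le (hlow i)
  have hinf : infOver (fun i : Fin n => (i : ℕ) < k)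
      (rowNorm (Qᵀ * ymat k hkn.le lam 0 Q X Gpinv)) = 1 := by
    refine infOver_eq_of_const (i := ⟨0, hk.trans hkn⟩) hk fun i hi => ?_
    have h := transpose_mul_ymat_zero_apply hkn.le lam Q X Gpinv hG1 hpos ⟨i, hi⟩
    have hcast : Fin.castLE hkn.le ⟨i, hi⟩ = i := rfl
    rw [hcast] at h
    simp [rowNorm, h, Matrix.one_apply]
  have hsup : supOver (fun i : Fin n => k ≤ (i : ℕ))
      (rowNorm (Qᵀ * ymat k hkn.le lam 0 Q X Gpinv)) ≤
        b ^ q * σ * specNorm Gpinv * (a ^ q * μ)⁻¹ := by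
    refine supOver_le (i := ⟨k, hkn⟩) le_rfl fun i hi => ?_
    rw [transpose_mul_ymat_zero, d1inv]
    refine (rowNorm_mul_diagonal_le (c := (a ^ q * μ)⁻¹) _ _ (fun j => ?_) (fun j => ?_)
      (inv_nonneg.mpr haμ.le) i).trans ?_
    · rw [dvec_zero]
      exact inv_nonneg.mpr (hpos j).le
    · rw [dvec_zero]
      exact inv_anti₀ haμ (hlow j)
    · refine mul_le_mul_of_nonneg_right ?_ (inv_nonneg.mpr haμ.le)
      refine (rowNorm_mul_le _ _ i).trans ?_
      rw [rowNorm_submatrix_snd, hPn]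
      refine mul_le_mul_of_nonneg_right ?_ (norm_nonneg _)
      exact mul_le_mul (pow_le_pow_left₀ (hmono i) (hlam (Fin.mk_le_mk.mpr hi)) q)
        (le_supOver _ hi) (rowNorm_nonneg _ _) (pow_nonneg (hmono _) q)
  rw [deltaK, hinf, div_one, gammaKM_vand_zero hk hkn, ekMat_self, Matrix.mul_one, gammaKM,
    ← hμ, ← hσ]
  refine hsup.trans_eq ?_
  rw [div_pow]
  field_simp
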